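/- For each i ∈ {0,1,2}, the function y ↦ (8/(1 + |y|²)²) Yᵢ(y)² is integrable on ℝ² with respect to Lebesgue measure and ∫_{ℝ²} (8/(1 + |y|²)²) Yᵢ(y)² dy = 32π/3, where Y₀(y) = 2(1 − |y|²)/(1 + |y|²) and Yᵢ(y) = 4yᵢ/(1 + |y|²) for i ∈ {1,2}. -/

import Mathlib

open MeasureTheory Real

/-- Y₀(y) = 2(1 − |y|²)/(1 + |y|²). -/
noncomputable def Y0 (y : EuclideanSpace ℝ (Fin 2)) : ℝ :=
  2 * (1 - ‖y‖ ^ 2) / (1 + ‖y‖ ^ 2)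

/-- Yᵢ(y) = 4 yᵢ/(1 + |y|²), for i ∈ {1,2} (indexed by `i : Fin 2`). -/
noncomputable def Ycoord (i : Fin 2) (y : EuclideanSpace ℝ (Fin 2)) : ℝ :=
  4 * y i / (1 + ‖y‖ ^ 2)

open Filter Topology Set in
/-- Integration of a nonnegative radial function on the Euclidean plane by means of a primitive
`G` of `r ↦ r * f r` vanishing at infinity. -/
theorem integrable_and_integral_radial_of_hasDerivAt {f G : ℝ → ℝ}
    (hderiv : ∀ r, HasDerivAt G (r * f r) r) (hf : ∀ r, 0 ≤ f r)
    (hG : Tendsto G atTop (𝓝 0)) :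
    Integrable (fun y : EuclideanSpace ℝ (Fin 2) => f ‖y‖) volume ∧
      ∫ y : EuclideanSpace ℝ (Fin 2), f ‖y‖ = 2 * π * (-G 0) := by
  have hnonneg : ∀ r ∈ Ioi (0 : ℝ), 0 ≤ r * f r := fun r hr => mul_nonneg (le_of_lt hr) (hf r)
  have hint := integrableOn_Ioi_deriv_of_nonneg' (fun r _ => hderiv r) hnonneg hG
  have hval := integral_Ioi_of_hasDerivAt_of_nonneg' (fun r _ => hderiv r) hnonneg hG
  constructor
  · rw [integrable_fun_norm_addHaar]
    simpa using hint
  · rw [integral_fun_norm_addHaar]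
    simp [measureReal_def, hval, pi_nonneg]
    ring

open Filter Topology in
theorem tendsto_inv_one_add_sq_pow {n : ℕ} (hn : n ≠ 0) :
    Tendsto (fun r : ℝ => (1 + r ^ 2)⁻¹ ^ n) atTop (𝓝 0) := by
  have h : Tendsto (fun r : ℝ => 1 + r ^ 2) atTop atTop :=
    tendsto_atTop_add_const_left _ _ (tendsto_pow_atTop two_ne_zero)
  simpa [hn] using h.inv_tendsto_atTop.pow n

theorem hasDerivAt_inv_one_add_sq_pow (n : ℕ) (r : ℝ) :
    HasDerivAt (fun r : ℝ => (1 + r ^ 2)⁻¹ ^ n)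
      (n * (1 + r ^ 2)⁻¹ ^ (n - 1) * (-(2 * r) / (1 + r ^ 2) ^ 2)) r := by
  have h : HasDerivAt (fun r : ℝ => 1 + r ^ 2) (2 * r) r := by
    simpa using (hasDerivAt_pow 2 r).const_add 1
  exact (h.fun_inv (by positivity)).fun_pow n

theorem integrable_and_integral_weight_Y0_sq :
    Integrable (fun y : EuclideanSpace ℝ (Fin 2) => 8 / (1 + ‖y‖ ^ 2) ^ 2 * (Y0 y) ^ 2) volume ∧
      ∫ y : EuclideanSpace ℝ (Fin 2), 8 / (1 + ‖y‖ ^ 2) ^ 2 * (Y0 y) ^ 2 = 32 * π / 3 := by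
  have key := integrable_and_integral_radial_of_hasDerivAt
    (f := fun r => 8 / (1 + r ^ 2) ^ 2 * (2 * (1 - r ^ 2) / (1 + r ^ 2)) ^ 2)
    (G := fun r => (-16) * (1 + r ^ 2)⁻¹ ^ 1 + 32 * (1 + r ^ 2)⁻¹ ^ 2
      + (-64 / 3) * (1 + r ^ 2)⁻¹ ^ 3) ?_ (fun r => by positivity) ?_
  · refine ⟨key.1, key.2.trans ?_⟩
    norm_num
    ring
  · intro r
    refine ((((hasDerivAt_inv_one_add_sq_pow 1 r).const_mul (-16)).add
      ((hasDerivAt_inv_one_add_sq_pow 2 r).const_mul 32)).add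
      ((hasDerivAt_inv_one_add_sq_pow 3 r).const_mul (-64 / 3))).congr_deriv ?_
    have : 1 + r ^ 2 ≠ 0 := by positivity
    norm_num only [inv_pow, Nat.cast_ofNat, Nat.cast_one, pow_zero, pow_one]
    field_simp
    ring
  · simpa using (((tendsto_inv_one_add_sq_pow one_ne_zero).const_mul (-16)).add
      ((tendsto_inv_one_add_sq_pow two_ne_zero).const_mul 32)).add
      ((tendsto_inv_one_add_sq_pow three_ne_zero).const_mul (-64 / 3))

theorem integrable_and_integral_weight_norm_sq :
    Integrable (fun y : EuclideanSpace ℝ (Fin 2) =>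
        8 / (1 + ‖y‖ ^ 2) ^ 2 * (4 * ‖y‖ / (1 + ‖y‖ ^ 2)) ^ 2) volume ∧
      ∫ y : EuclideanSpace ℝ (Fin 2),
        8 / (1 + ‖y‖ ^ 2) ^ 2 * (4 * ‖y‖ / (1 + ‖y‖ ^ 2)) ^ 2 = 64 * π / 3 := by
  have key := integrable_and_integral_radial_of_hasDerivAt
    (f := fun r => 8 / (1 + r ^ 2) ^ 2 * (4 * r / (1 + r ^ 2)) ^ 2)
    (G := fun r => (-32) * (1 + r ^ 2)⁻¹ ^ 2 + (64 / 3) * (1 + r ^ 2)⁻¹ ^ 3)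
    ?_ (fun r => by positivity) ?_
  · refine ⟨key.1, key.2.trans ?_⟩
    norm_num
    ring
  · intro r
    refine (((hasDerivAt_inv_one_add_sq_pow 2 r).const_mul (-32)).add
      ((hasDerivAt_inv_one_add_sq_pow 3 r).const_mul (64 / 3))).congr_deriv ?_
    have : 1 + r ^ 2 ≠ 0 := by positivity
    norm_num only [inv_pow, Nat.cast_ofNat, Nat.cast_one, pow_zero, pow_one]
    field_simp
    ring
  · simpa using ((tendsto_inv_one_add_sq_pow two_ne_zero).const_mul (-32)).add
      ((tendsto_inv_one_add_sq_pow three_ne_zero).const_mul (64 / 3))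

theorem integrable_weight_Ycoord_sq (i : Fin 2) :
    Integrable (fun y : EuclideanSpace ℝ (Fin 2) =>
      8 / (1 + ‖y‖ ^ 2) ^ 2 * (Ycoord i y) ^ 2) volume := by
  refine integrable_and_integral_weight_norm_sq.1.mono' ?_ (.of_forall fun y => ?_)
  · unfold Ycoord
    exact Measurable.aestronglyMeasurable (by fun_prop)
  · have h : (y i) ^ 2 ≤ ‖y‖ ^ 2 := by
      simpa using pow_le_pow_left₀ (norm_nonneg _) (PiLp.norm_apply_le y i) 2
    rw [Real.norm_of_nonneg (by positivity), Ycoord, div_pow, div_pow, mul_pow, mul_pow]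
    gcongr

theorem integral_weight_Ycoord_sq_zero_eq_one :
    ∫ y : EuclideanSpace ℝ (Fin 2), 8 / (1 + ‖y‖ ^ 2) ^ 2 * (Ycoord 0 y) ^ 2 =
      ∫ y : EuclideanSpace ℝ (Fin 2), 8 / (1 + ‖y‖ ^ 2) ^ 2 * (Ycoord 1 y) ^ 2 := by
  let e : EuclideanSpace ℝ (Fin 2) ≃ₗᵢ[ℝ] EuclideanSpace ℝ (Fin 2) :=
    LinearIsometryEquiv.piLpCongrLeft 2 ℝ ℝ (Equiv.swap 0 1)
  rw [← e.measurePreserving.integral_comp e.toMeasurableEquiv.measurableEmbedding]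
  have h (y : EuclideanSpace ℝ (Fin 2)) : e y 0 = y 1 := by
    simp [e, LinearIsometryEquiv.piLpCongrLeft_apply, Equiv.piCongrLeft'_apply]
  simp only [Ycoord, h, LinearIsometryEquiv.norm_map]

theorem integral_weight_Ycoord_sq (i : Fin 2) :
    ∫ y : EuclideanSpace ℝ (Fin 2), 8 / (1 + ‖y‖ ^ 2) ^ 2 * (Ycoord i y) ^ 2 = 32 * π / 3 := by
  have hsum := integral_add (integrable_weight_Ycoord_sq 0) (integrable_weight_Ycoord_sq 1)
  have hpt : ∀ y : EuclideanSpace ℝ (Fin 2),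
      8 / (1 + ‖y‖ ^ 2) ^ 2 * (Ycoord 0 y) ^ 2 + 8 / (1 + ‖y‖ ^ 2) ^ 2 * (Ycoord 1 y) ^ 2 =
        8 / (1 + ‖y‖ ^ 2) ^ 2 * (4 * ‖y‖ / (1 + ‖y‖ ^ 2)) ^ 2 := by
    intro y
    have h : ‖y‖ ^ 2 = y 0 ^ 2 + y 1 ^ 2 := by
      simp [EuclideanSpace.norm_sq_eq]
    rw [Ycoord, Ycoord, div_pow, div_pow, div_pow, mul_pow 4 ‖y‖, h]
    ring
  simp only [hpt] at hsum
  rw [integrable_and_integral_weight_norm_sq.2] at hsum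
  have heq := integral_weight_Ycoord_sq_zero_eq_one
  fin_cases i
  · change ∫ y, 8 / (1 + ‖y‖ ^ 2) ^ 2 * (Ycoord 0 y) ^ 2 = _
    linarith
  · change ∫ y, 8 / (1 + ‖y‖ ^ 2) ^ 2 * (Ycoord 1 y) ^ 2 = _
    linarith

theorem integral_weight_Y_sq :
    (Integrable (fun y : EuclideanSpace ℝ (Fin 2) =>
          8 / (1 + ‖y‖ ^ 2) ^ 2 * (Y0 y) ^ 2) volume ∧
        ∫ y : EuclideanSpace ℝ (Fin 2), 8 / (1 + ‖y‖ ^ 2) ^ 2 * (Y0 y) ^ 2 = 32 * π / 3) ∧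
      ∀ i : Fin 2,
        Integrable (fun y : EuclideanSpace ℝ (Fin 2) =>
            8 / (1 + ‖y‖ ^ 2) ^ 2 * (Ycoord i y) ^ 2) volume ∧
          ∫ y : EuclideanSpace ℝ (Fin 2),
              8 / (1 + ‖y‖ ^ 2) ^ 2 * (Ycoord i y) ^ 2 = 32 * π / 3 :=
  ⟨integrable_and_integral_weight_Y0_sq,
    fun i => ⟨integrable_weight_Ycoord_sq i, integral_weight_Ycoord_sq i⟩⟩
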